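/- A sparse d-way tensor A ∈ ℝ^{n₁×⋯×n_d} with R nonzero p-fibers (1 < p < d) admits an exact tensor train representation with all TT ranks equal to R, in which every core except the p-th has entries in {0,1}, and for each fixed middle index the slice matrices of all cores are diagonal R×R matrices. -/

import Mathlib

/-- Evaluation of a chain (matrix product) of TT cores, encoded as ℕ-indexed matrices. -/
noncomputable def ttChain (G : ℕ → ℕ → ℕ → ℝ) (r : ℕ → ℕ) : ℕ → ℕ → ℕ → ℝ
  | 0, i, j => if i = j then 1 else 0
  | k + 1, i, j => ∑ t ∈ Finset.range (r k), ttChain G r k i t * G k t j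

/-- Reconstruct a full multi-index from an index tuple on all modes except `p`
together with a value for mode `p`. -/
def glue {d : ℕ} (n : ℕ → ℕ) (p : Fin d)
    (j : (k : {k : Fin d // k ≠ p}) → Fin (n k.1.val)) (t : Fin (n p.val)) :
    (k : Fin d) → Fin (n k.val) := fun k =>
  if h : k = p then Fin.cast (congrArg n (congrArg Fin.val h.symm)) t else j ⟨k, h⟩

/-- If the first core is a row and the following ones are diagonal, then the entries of the chain
are products of diagonal entries. -/
theorem ttChain_succ_of_diagonal {H : ℕ → ℕ → ℕ → ℝ} {r : ℕ → ℕ} {c : ℕ → ℕ → ℝ} {R : ℕ}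
    (h0 : ∀ b < R, H 0 0 b = c 0 b) (hr0 : r 0 = 1) (k : ℕ)
    (hr : ∀ l, 0 < l → l ≤ k → r l = R)
    (hH : ∀ l, 0 < l → l ≤ k → ∀ a b, H l a b = if a = b then c l a else 0)
    {j : ℕ} (hj : j < R) :
    ttChain H r (k + 1) 0 j = ∏ l ∈ Finset.range (k + 1), c l j := by
  induction k with
  | zero => simp [ttChain, hr0, h0 j hj]
  | succ k ih =>
    have ih' := ih (fun l hl hlk => hr l hl (by omega)) (fun l hl hlk => hH l hl (by omega))
    rw [ttChain, hr (k + 1) (by omega) le_rfl, Finset.prod_range_succ, ← ih',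
      Finset.sum_eq_single_of_mem j (Finset.mem_range.2 hj)]
    · rw [hH (k + 1) (by omega) le_rfl, if_pos rfl]
    · intro t _ htj
      rw [hH (k + 1) (by omega) le_rfl, if_neg htj, mul_zero]

theorem glue_restrict {d : ℕ} (n : ℕ → ℕ) (p : Fin d) (idx : (k : Fin d) → Fin (n k.val)) :
    glue n p (fun k => idx k.1) (idx p) = idx := by
  funext k
  unfold glue
  split_ifs with h
  · subst h; rfl
  · rfl

open Classical in
/-- The `k`-th factor of the rank-one tensor carrying the `p`-fiber of `A` at position `j`. -/
noncomputable def fiberFactor {d : ℕ} (n : ℕ → ℕ) (p : Fin d)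
    (A : ((k : Fin d) → Fin (n k.val)) → ℝ)
    (j : (k : {k : Fin d // k ≠ p}) → Fin (n k.1.val)) (k : Fin d) (i : Fin (n k.val)) : ℝ :=
  if h : k = p then A (glue n p j (Fin.cast (congrArg n (congrArg Fin.val h)) i))
  else if j ⟨k, h⟩ = i then 1 else 0

open Classical in
theorem prod_fiberFactor {d : ℕ} (n : ℕ → ℕ) (p : Fin d)
    (A : ((k : Fin d) → Fin (n k.val)) → ℝ)
    (j : (k : {k : Fin d // k ≠ p}) → Fin (n k.1.val)) (idx : (k : Fin d) → Fin (n k.val)) :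
    ∏ k, fiberFactor n p A j k (idx k) = if j = (fun k : {k : Fin d // k ≠ p} => idx k.1) then A idx else 0 := by
  split_ifs with hj
  · subst hj
    rw [Finset.prod_eq_single p]
    · simp [fiberFactor, glue_restrict]
    · intro k _ hk
      simp [fiberFactor, hk]
    · simp
  · obtain ⟨k, hk⟩ := Function.ne_iff.1 hj
    exact Finset.prod_eq_zero (Finset.mem_univ k.1) (by simp [fiberFactor, k.2, hk])

open Classical in
/-- A tensor is the sum of the rank-one tensors carrying its nonzero `p`-fibers. -/
theorem sum_prod_fiberFactor {d : ℕ} (n : ℕ → ℕ) (p : Fin d)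
    (A : ((k : Fin d) → Fin (n k.val)) → ℝ) (idx : (k : Fin d) → Fin (n k.val)) :
    ∑ j ∈ Finset.univ.filter (fun j : (k : {k : Fin d // k ≠ p}) → Fin (n k.1.val) =>
      ∃ t, A (glue n p j t) ≠ 0), ∏ k, fiberFactor n p A j k (idx k) = A idx := by
  simp only [prod_fiberFactor]
  rw [Finset.sum_ite_eq']
  split_ifs with h
  · rfl
  · by_contra hA
    refine h (Finset.mem_filter.2 ⟨Finset.mem_univ _, idx p, ?_⟩)
    rw [glue_restrict]
    exact fun h0 => hA h0.symm

open Classical in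
/-- A sparse `d`-way tensor with `R` nonzero `p`-fibers
(`p` an interior mode, i.e. `1 < p < d` in 1-based terms) admits an exact TT
representation whose interior TT ranks all equal `R` (boundary ranks are 1),
in which every core except the `p`-th has entries in `{0,1}`, and the slice
matrices of all interior cores are diagonal `R×R` matrices. -/
theorem sparse_tensor_exact_tt_rank_R
    (d : ℕ) (n : ℕ → ℕ) (p : Fin d) (hp1 : 0 < p.val) (hp2 : p.val < d - 1)
    (A : ((k : Fin d) → Fin (n k.val)) → ℝ)
    (R : ℕ)
    (hR : R = (Finset.univ.filter
      (fun j : (k : {k : Fin d // k ≠ p}) → Fin (n k.1.val) =>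
        ∃ t, A (glue n p j t) ≠ 0)).card) :
    ∃ G : (k : Fin d) → Fin (n k.val) → ℕ → ℕ → ℝ,
      -- exact TT representation with interior ranks all equal to R
      (∀ idx : (k : Fin d) → Fin (n k.val),
        A idx = ttChain
          (fun k a b => if h : k < d then G ⟨k, h⟩ (idx ⟨k, h⟩) a b else 0)
          (fun k => if k = 0 ∨ k = d then 1 else R) d 0 0) ∧
      -- every core except the p-th has entries in {0,1}
      (∀ k : Fin d, k ≠ p → ∀ i a b, G k i a b = 0 ∨ G k i a b = 1) ∧
      -- the slices of all interior cores are diagonal R×R matrices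
      (∀ k : Fin d, 0 < k.val → k.val < d - 1 → ∀ i a b, a ≠ b → G k i a b = 0) := by
  let S := Finset.univ.filter (fun j : (k : {k : Fin d // k ≠ p}) → Fin (n k.1.val) =>
    ∃ t, A (glue n p j t) ≠ 0)
  let e : Fin R ≃ S := (S.equivFinOfCardEq hR.symm).symm
  let c : (k : Fin d) → Fin (n k.val) → ℕ → ℝ := fun k i a =>
    if ha : a < R then fiberFactor n p A (e ⟨a, ha⟩).1 k i else 0
  have hc : ∀ k, k ≠ p → ∀ i a, c k i a = 0 ∨ c k i a = 1 := by
    intro k hk i a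
    simp only [c, fiberFactor, hk, dite_false]
    split_ifs <;> simp
  refine ⟨fun k i a b => if k.val = 0 then c k i b else if k.val = d - 1 then c k i a
    else if a = b then c k i a else 0, fun idx => ?_, fun k hk i a b => ?_,
    fun k h0 h1 i a b hab => ?_⟩
  · obtain ⟨m, rfl⟩ : ∃ m, d = m + 2 := ⟨d - 2, by omega⟩
    have hprod : ∀ a : Fin R, (∏ l ∈ Finset.range (m + 2),
        if h : l < m + 2 then c ⟨l, h⟩ (idx ⟨l, h⟩) a.val else 0) =
        ∏ k, fiberFactor n p A (e a).1 k (idx k) := by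
      intro a
      rw [Finset.prod_range]
      simp [c]
    rw [ttChain, if_neg (by omega), ← sum_prod_fiberFactor n p A idx, ← Finset.sum_coe_sort,
      ← Equiv.sum_comp e, Finset.sum_range]
    refine Finset.sum_congr rfl fun a _ => ?_
    rw [ttChain_succ_of_diagonal (R := R)
      (c := fun l a => if h : l < m + 2 then c ⟨l, h⟩ (idx ⟨l, h⟩) a else 0)
      _ _ _ _ _ a.2, ← hprod, Finset.prod_range_succ _ (m + 1)]
    · simp
    · intro b _
      simp
    · simp
    · intro l hl hlm
      rw [if_neg (by omega)]
    · intro l hl hlm a b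
      have h1 : l < m + 2 := by omega
      have h2 : l ≠ 0 := by omega
      have h3 : l ≠ m + 1 := by omega
      simp [h1, h2, h3]
  · dsimp only
    split_ifs
    · exact hc k hk i b
    · exact hc k hk i a
    · exact hc k hk i a
    · exact Or.inl rfl
  · simp [h0.ne', h1.ne, hab]
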